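/- arXiv:2009.03150 — 5 statements merged into one kernel-verified Lean document; each statement's English description precedes it below -/
import Mathlib

section
/- Let m,n ≥ 1, let ‖·‖ be a differentiable, strictly convex norm on ℝ² that is not a scalar multiple of the Euclidean norm, let α ∈ [0,π/2), and let G(B) be an m×n braced grid framework of inclination α. Then the following are equivalent: (i) G(B) is infinitesimally rigid in (ℝ²,‖·‖); (ii) the fully (doubly) braced grid G(B_max) of inclination α is infinitesimally rigid in (ℝ²,‖·‖), and the bicoloured braces graph of G(B) is a spanning subgraph of K²_{m,n} each of whose connected components contains a cycle with an independent colouring. -/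
open Asymptotics

abbrev V2 : Type := ℝ × ℝ

/-- The standard dot product on `ℝ × ℝ`. -/
def dot (v w : V2) : ℝ := v.1 * w.1 + v.2 * w.2

/-- The Euclidean norm on `ℝ × ℝ`. -/
noncomputable def eucNorm (v : V2) : ℝ := Real.sqrt (v.1 ^ 2 + v.2 ^ 2)

/-- Rotation by `π/2`. -/
def rot90 (v : V2) : V2 := (-v.2, v.1)

/-- A bar-joint framework in the plane: a placement of joints and a set of bars. -/
structure Framework (J : Type) where
  pos : J → V2
  bars : Set (J × J)

/-- A Euclidean infinitesimal flex. -/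
def IsEucFlex {J : Type} (F : Framework J) (u : J → V2) : Prop :=
  ∀ e ∈ F.bars, dot (u e.1 - u e.2) (F.pos e.1 - F.pos e.2) = 0

/-- A Euclidean rigid motion flex: `u i = c + θ • J (p i)`. -/
def IsRigidMotionFlex {J : Type} (F : Framework J) (u : J → V2) : Prop :=
  ∃ (c : V2) (θ : ℝ), ∀ i, u i = c + θ • rot90 (F.pos i)

/-- Euclidean infinitesimal rigidity. -/
def EucRigid {J : Type} (F : Framework J) : Prop :=
  ∀ u, IsEucFlex F u → IsRigidMotionFlex F u

/-- An infinitesimal flex with respect to a general norm `ν`: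
`ν (p i + t u i - (p j + t u j)) - ν (p i - p j) = o(t)` as `t → 0+`, for each bar. -/
def IsFlex (ν : V2 → ℝ) {J : Type} (F : Framework J) (u : J → V2) : Prop :=
  ∀ e ∈ F.bars,
    (fun t : ℝ =>
        ν (F.pos e.1 + t • u e.1 - (F.pos e.2 + t • u e.2)) - ν (F.pos e.1 - F.pos e.2))
      =o[nhdsWithin 0 (Set.Ioi 0)] (id : ℝ → ℝ)

/-- Infinitesimal rigidity for a (non-Euclidean) norm: every flex is a translation,
i.e. a constant velocity field. -/
def NormRigid (ν : V2 → ℝ) {J : Type} (F : Framework J) : Prop :=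
  ∀ u, IsFlex ν F u → ∀ i j, u i = u j

/-- `ν` is a norm on `ℝ²`. -/
def IsNormFn (ν : V2 → ℝ) : Prop :=
  (∀ v, ν v = 0 ↔ v = 0) ∧ (∀ (c : ℝ) (v : V2), ν (c • v) = |c| * ν v) ∧
    ∀ v w : V2, ν (v + w) ≤ ν v + ν w

/-- `ν` is differentiable (away from the origin). -/
def SmoothNorm (ν : V2 → ℝ) : Prop := ∀ v : V2, v ≠ 0 → DifferentiableAt ℝ ν v

/-- `ν` is strictly convex. -/
def StrictlyConvexNorm (ν : V2 → ℝ) : Prop :=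
  ∀ v w : V2, ν v = 1 → ν w = 1 → v ≠ w → ν ((1 / 2 : ℝ) • (v + w)) < 1

/-- `ν` is not a scalar multiple of the Euclidean norm. -/
def NonEuclidean (ν : V2 → ℝ) : Prop := ¬∃ c : ℝ, ∀ v, ν v = c * eucNorm v

/-- The point of the unit sphere of `ν` in the direction `θ`. -/
noncomputable def sphPt (ν : V2 → ℝ) (θ : ℝ) : V2 :=
  (ν (Real.cos θ, Real.sin θ))⁻¹ • ((Real.cos θ, Real.sin θ) : V2)

/-- `w` is tangent to the unit sphere of `ν` at the point `q`. -/
def IsTangentAt (ν : V2 → ℝ) (q w : V2) : Prop := fderiv ℝ ν q w = 0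

/-- The positively oriented unit tangent vector to the unit sphere of `ν`
at its point in the direction `θ`. -/
def IsPosUnitTangent (ν : V2 → ℝ) (θ : ℝ) (w : V2) : Prop :=
  ν w = 1 ∧ IsTangentAt ν (sphPt ν θ) w ∧
    0 < (sphPt ν θ).1 * w.2 - (sphPt ν θ).2 * w.1

/-- Rotation of the plane by the angle `α`. -/
noncomputable def rotv (α : ℝ) (v : V2) : V2 :=
  (v.1 * Real.cos α - v.2 * Real.sin α, v.1 * Real.sin α + v.2 * Real.cos α)

/-- The joints of the `m × n` grid. -/
abbrev Joint (m n : ℕ) := Fin (m + 1) × Fin (n + 1)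

/-- A brace: a square `(j,k)` together with a colour (`true` = blue diagonal
from `(j,k)` to `(j+1,k+1)`, `false` = red diagonal from `(j+1,k)` to `(j,k+1)`). -/
abbrev Brace (m n : ℕ) := Fin m × Fin n × Bool

/-- The bars of the unbraced `m × n` grid: unit horizontal and vertical segments. -/
def gridBars (m n : ℕ) : Set (Joint m n × Joint m n) :=
  {e | ((e.1.1 : ℕ) + 1 = (e.2.1 : ℕ) ∧ e.1.2 = e.2.2) ∨
      (e.1.1 = e.2.1 ∧ (e.1.2 : ℕ) + 1 = (e.2.2 : ℕ))}

/-- The bar corresponding to a brace. -/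
def braceBar {m n : ℕ} (b : Brace m n) : Joint m n × Joint m n :=
  if b.2.2 then ((b.1.castSucc, b.2.1.castSucc), (b.1.succ, b.2.1.succ))
  else ((b.1.succ, b.2.1.castSucc), (b.1.castSucc, b.2.1.succ))

/-- The axis-aligned braced `m × n` grid framework `G(B)`. -/
noncomputable def plainBracedGrid (m n : ℕ) (B : Set (Brace m n)) : Framework (Joint m n) where
  pos := fun v => ((v.1 : ℝ), (v.2 : ℝ))
  bars := gridBars m n ∪ braceBar '' B

/-- The braced `m × n` grid framework `G(B)` of inclination `α`. -/
noncomputable def bracedGrid (m n : ℕ) (α : ℝ) (B : Set (Brace m n)) : Framework (Joint m n) where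
  pos := fun v => rotv α ((v.1 : ℝ), (v.2 : ℝ))
  bars := gridBars m n ∪ braceBar '' B

/-- The braced `m × n` grid of `a × b` rectangles with inclination `α`. -/
noncomputable def bracedRectGrid (m n : ℕ) (a b α : ℝ) (B : Set (Brace m n)) :
    Framework (Joint m n) where
  pos := fun v => rotv α ((v.1 : ℝ) * a, (v.2 : ℝ) * b)
  bars := gridBars m n ∪ braceBar '' B

/-- The unbraced axis-aligned `m × n` grid framework. -/
noncomputable def unbracedGrid (m n : ℕ) : Framework (Joint m n) where
  pos := fun v => ((v.1 : ℝ), (v.2 : ℝ))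
  bars := gridBars m n

/-- The lines of the grid: `Sum.inl k` is the horizontal line at height `k`,
`Sum.inr j` is the vertical line at abscissa `j`. -/
abbrev LineIdx (m n : ℕ) := Fin (n + 1) ⊕ Fin (m + 1)

/-- The basis velocity field `u_l` supported on the joints of the line `l`. -/
def lineField (m n : ℕ) (l : LineIdx m n) : Joint m n → V2 := fun v =>
  match l with
  | Sum.inl k => if v.2 = k then (1, 0) else (0, 0)
  | Sum.inr j => if v.1 = j then (0, 1) else (0, 0)

/-- The ribbons of the grid: `Sum.inl j` is the vertical ribbon `[j,j+1] × [0,n]`,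
`Sum.inr k` is the horizontal ribbon `[0,m] × [k,k+1]`. -/
abbrev RibbonIdx (m n : ℕ) := Fin m ⊕ Fin n

/-- The sheer map on coefficient fields: `σ(u)(ρ) = d_{l₁} - d_{l₂}` for the boundary
lines `l₁` (right-hand, resp. lower) and `l₂` of the ribbon `ρ`. -/
def sheer {m n : ℕ} (d : LineIdx m n → ℝ) : RibbonIdx m n → ℝ := fun ρ =>
  match ρ with
  | Sum.inl j => d (Sum.inr j.succ) - d (Sum.inr j.castSucc)
  | Sum.inr k => d (Sum.inl k.castSucc) - d (Sum.inl k.succ)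

/-- The row of the Euclidean stress-sheer matrix indexed by a brace. -/
def eucSSRow {m n : ℕ} (b : Brace m n) : RibbonIdx m n → ℝ := fun ρ =>
  match ρ with
  | Sum.inl j => if j = b.1 then 1 else 0
  | Sum.inr k => if k = b.2.1 then -1 else 0

/-- The row of the Euclidean stress-sheer matrix of the fully braced grid
indexed by a square. -/
def eucSqRow {m n : ℕ} (s : Fin m × Fin n) : RibbonIdx m n → ℝ := fun ρ =>
  match ρ with
  | Sum.inl j => if j = s.1 then 1 else 0
  | Sum.inr k => if k = s.2 then -1 else 0

/-- The row of the non-Euclidean stress-sheer matrix `SS_{λ,λ'}` indexed by a brace: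
`+1` at the vertical ribbon, `-λ` (blue) or `-λ'` (red) at the horizontal ribbon. -/
def neRow {m n : ℕ} (lam lam' : ℝ) (b : Brace m n) : RibbonIdx m n → ℝ := fun ρ =>
  match ρ with
  | Sum.inl j => if j = b.1 then 1 else 0
  | Sum.inr k => if k = b.2.1 then (if b.2.2 then -lam else -lam') else 0

/-- Adjacency of rows (`Sum.inl`) and columns (`Sum.inr`) in the (bicoloured) braces
graph with edge set `B`. -/
def bracesAdj {m n : ℕ} (B : Set (Brace m n)) (v w : Fin m ⊕ Fin n) : Prop :=
  ∃ e ∈ B, (v = Sum.inl e.1 ∧ w = Sum.inr e.2.1) ∨ (w = Sum.inl e.1 ∧ v = Sum.inr e.2.1)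

/-- A (bicoloured) cycle of length `2(k+1)` in `K²_{m,n}`: rows `row 0, …, row k`,
columns `col 0, …, col k`, odd edges `e_{2i+1} = (row i, col i, c1 i)` and even edges
`e_{2i+2} = (row (i+1), col i, c2 i)` (cyclically); all `2(k+1)` edges are distinct. -/
structure BCycle (m n : ℕ) where
  k : ℕ
  row : Fin (k + 1) → Fin m
  col : Fin (k + 1) → Fin n
  c1 : Fin (k + 1) → Bool
  c2 : Fin (k + 1) → Bool
  rowInj : Function.Injective row
  colInj : Function.Injective col
  nontriv : k = 0 → c1 ≠ c2

/-- The odd edges of a bicoloured cycle. -/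
def BCycle.edge1 {m n : ℕ} (C : BCycle m n) (i : Fin (C.k + 1)) : Brace m n :=
  (C.row i, C.col i, C.c1 i)

/-- The even edges of a bicoloured cycle. -/
def BCycle.edge2 {m n : ℕ} (C : BCycle m n) (i : Fin (C.k + 1)) : Brace m n :=
  (C.row (i + 1), C.col i, C.c2 i)

/-- The edge set of a bicoloured cycle. -/
def BCycle.edges {m n : ℕ} (C : BCycle m n) : Set (Brace m n) :=
  Set.range C.edge1 ∪ Set.range C.edge2

/-- Dependent colouring: the number of blue edges in odd position equals the number
of blue edges in even position. -/
def BCycle.DepColouring {m n : ℕ} (C : BCycle m n) : Prop :=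
  (Finset.univ.filter fun i => C.c1 i = true).card =
    (Finset.univ.filter fun i => C.c2 i = true).card

/-- Linear independence of the set of rows of `SS_{λ,λ'}` indexed by `S`. -/
def RowsIndep (m n : ℕ) (lam lam' : ℝ) (S : Set (Brace m n)) : Prop :=
  LinearIndependent ℝ fun e : S => neRow lam lam' (e : Brace m n)

/-- `S` is a circuit of the row matroid of `SS_{λ,λ'}`: a minimal dependent set of rows. -/
def IsCircuit (m n : ℕ) (lam lam' : ℝ) (S : Set (Brace m n)) : Prop :=
  ¬RowsIndep m n lam lam' S ∧ ∀ S' ⊂ S, RowsIndep m n lam lam' S'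

/-- `S ⊆ K²_{m,n}` is a spanning independent cycle-rooted forest: every connected
component (of the multigraph with edge set `S` on the `m + n` vertices) has as many
edges as vertices, i.e. is a cycle-rooted tree (so in particular `S` is spanning),
and every cycle of edges in `S` has an independent colouring. -/
def IsSpanningICRF (m n : ℕ) (S : Set (Brace m n)) : Prop :=
  (∀ v : Fin m ⊕ Fin n,
      {e ∈ S | Relation.ReflTransGen (bracesAdj S) v (Sum.inl e.1)}.ncard =
        {w | Relation.ReflTransGen (bracesAdj S) v w}.ncard) ∧
  ∀ C : BCycle m n, C.edges ⊆ S → ¬C.DepColouring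

/-- The `p`-norm on the plane. -/
noncomputable def pNorm (p : ℝ) : V2 → ℝ := fun v => (|v.1| ^ p + |v.2| ^ p) ^ (1 / p)

/-- The sup norm on the plane. -/
noncomputable def supNorm : V2 → ℝ := fun v => max |v.1| |v.2|

/-! ### Norms and their derivatives -/

lemma IsNormFn.map_neg {ν : V2 → ℝ} (hν : IsNormFn ν) (v : V2) : ν (-v) = ν v := by
  simpa using hν.2.1 (-1) v

lemma IsNormFn.nonneg {ν : V2 → ℝ} (hν : IsNormFn ν) (v : V2) : 0 ≤ ν v := by
  have h := hν.2.2 v (-v)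
  rw [hν.map_neg, add_neg_cancel, (hν.1 0).2 rfl] at h
  linarith

lemma IsNormFn.pos {ν : V2 → ℝ} (hν : IsNormFn ν) {v : V2} (hv : v ≠ 0) : 0 < ν v :=
  lt_of_le_of_ne (hν.nonneg v) fun h => hv ((hν.1 v).1 h.symm)

lemma hasDerivAt_line {ν : V2 → ℝ} (hs : SmoothNorm ν) {v : V2} (hv : v ≠ 0) (w : V2) :
    HasDerivAt (fun t : ℝ => ν (v + t • w)) (fderiv ℝ ν v w) 0 := by
  have h1 : HasDerivAt (fun t : ℝ => v + t • w) w 0 := by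
    simpa using ((hasDerivAt_id (0 : ℝ)).smul_const w).const_add v
  have h2 : HasFDerivAt ν (fderiv ℝ ν v) (v + (0 : ℝ) • w) := by
    simpa using (hs v hv).hasFDerivAt
  exact h2.comp_hasDerivAt 0 h1

lemma fderiv_self {ν : V2 → ℝ} (hν : IsNormFn ν) (hs : SmoothNorm ν) {v : V2} (hv : v ≠ 0) :
    fderiv ℝ ν v v = ν v := by
  have h1 := hasDerivAt_line hs hv v
  have h2 : HasDerivAt (fun t : ℝ => (1 + t) * ν v) (ν v) 0 := by
    simpa using ((hasDerivAt_id (0 : ℝ)).const_add 1).mul_const (ν v)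
  refine h1.unique (h2.congr_of_eventuallyEq ?_)
  filter_upwards [lt_mem_nhds (show (-1 : ℝ) < 0 by norm_num)] with t ht
  rw [show v + t • v = (1 + t) • v by rw [add_smul, one_smul], hν.2.1, abs_of_pos (by linarith)]

lemma fderiv_le {ν : V2 → ℝ} (hν : IsNormFn ν) (hs : SmoothNorm ν) {v : V2} (hv : v ≠ 0)
    (w : V2) : fderiv ℝ ν v w ≤ ν w := by
  have h1 := (hasDerivAt_line hs hv w).hasDerivWithinAt (s := Set.Ioi 0)
  rw [hasDerivWithinAt_iff_tendsto_slope' (by simp)] at h1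
  refine le_of_tendsto h1 ?_
  filter_upwards [self_mem_nhdsWithin] with t ht
  have ht' : (0 : ℝ) < t := ht
  rw [slope_def_field, zero_smul, add_zero, sub_zero, div_le_iff₀ ht']
  have h2 := hν.2.2 v (t • w)
  rw [hν.2.1, abs_of_pos ht'] at h2
  linarith

lemma fderiv_lt {ν : V2 → ℝ} (hν : IsNormFn ν) (hs : SmoothNorm ν)
    (hc : StrictlyConvexNorm ν) {v w : V2} (h : v.1 * w.2 - v.2 * w.1 ≠ 0) :
    fderiv ℝ ν v w < ν w := by
  have hv : v ≠ 0 := by rintro rfl; simp at h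
  have hw : w ≠ 0 := by rintro rfl; simp at h
  have pv := hν.pos hv
  have pw := hν.pos hw
  refine lt_of_le_of_ne (fderiv_le hν hs hv w) fun heq => ?_
  have hunit : ∀ z : V2, 0 < ν z → ν ((ν z)⁻¹ • z) = 1 := fun z hz => by
    rw [hν.2.1, abs_of_pos (inv_pos.2 hz), inv_mul_cancel₀ hz.ne']
  have h1 := hc _ _ (hunit v pv) (hunit w pw) fun he => h <| by
    have e1 : w = (ν w * (ν v)⁻¹) • v := by
      rw [mul_smul, he, smul_smul, mul_inv_cancel₀ pw.ne', one_smul]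
    generalize ν w * (ν v)⁻¹ = c at e1
    subst e1
    simp only [Prod.smul_fst, Prod.smul_snd, smul_eq_mul]
    ring
  have h2 := fderiv_le hν hs hv ((1 / 2 : ℝ) • ((ν v)⁻¹ • v + (ν w)⁻¹ • w))
  simp only [map_add, map_smul, smul_eq_mul, heq, fderiv_self hν hs hv] at h2
  rw [inv_mul_cancel₀ pv.ne', inv_mul_cancel₀ pw.ne'] at h2
  linarith

lemma abs_fderiv_lt {ν : V2 → ℝ} (hν : IsNormFn ν) (hs : SmoothNorm ν)
    (hc : StrictlyConvexNorm ν) {v w : V2} (h : v.1 * w.2 - v.2 * w.1 ≠ 0) :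
    |fderiv ℝ ν v w| < ν w := by
  rw [abs_lt]
  refine ⟨?_, fderiv_lt hν hs hc h⟩
  have h1 := fderiv_lt hν hs hc (v := v) (w := -w) fun h0 => h <| by
    simp only [Prod.fst_neg, Prod.snd_neg] at h0
    linarith
  rw [map_neg, hν.map_neg] at h1
  linarith

/-- The duality map of a smooth strictly convex norm in the plane preserves orientation. -/
lemma fderiv_cross_pos {ν : V2 → ℝ} (hν : IsNormFn ν) (hs : SmoothNorm ν)
    (hc : StrictlyConvexNorm ν) {v w : V2} (h : v.1 * w.2 - v.2 * w.1 ≠ 0) :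
    0 < fderiv ℝ ν v v * fderiv ℝ ν w w - fderiv ℝ ν v w * fderiv ℝ ν w v := by
  have hv : v ≠ 0 := by rintro rfl; simp at h
  have hw : w ≠ 0 := by rintro rfl; simp at h
  rw [fderiv_self hν hs hv, fderiv_self hν hs hw, sub_pos]
  have h1 := abs_fderiv_lt hν hs hc h
  have h2 := abs_fderiv_lt hν hs hc (v := w) (w := v) fun h0 => h (by linarith)
  calc fderiv ℝ ν v w * fderiv ℝ ν w v
      ≤ |fderiv ℝ ν v w| * |fderiv ℝ ν w v| := by rw [← abs_mul]; exact le_abs_self _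
    _ < ν w * ν v := mul_lt_mul'' h1 h2 (abs_nonneg _) (abs_nonneg _)
    _ = ν v * ν w := mul_comm _ _

/-- The first-order length condition on a bar, in terms of the derivative of the norm. -/
lemma bar_isLittleO_iff {ν : V2 → ℝ} (hν : IsNormFn ν) (hs : SmoothNorm ν) {p q d : V2}
    (hd : q - p = d) (hd0 : d ≠ 0) (v w : V2) :
    ((fun t : ℝ => ν (p + t • v - (q + t • w)) - ν (p - q))
      =o[nhdsWithin 0 (Set.Ioi 0)] (id : ℝ → ℝ)) ↔ fderiv ℝ ν d (w - v) = 0 := by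
  subst hd
  have e : (fun t : ℝ => ν (p + t • v - (q + t • w)) - ν (p - q)) =
      fun t : ℝ => ν (q - p + t • (w - v)) - ν (q - p) := by
    funext t
    rw [← hν.map_neg (p - q), ← hν.map_neg (p + t • v - (q + t • w)), neg_sub, neg_sub, smul_sub]
    congr 2
    abel
  rw [e]
  have h1 := ((hasDerivAt_line hs hd0 (w - v)).hasDerivWithinAt (s := Set.Ioi 0)).isLittleO
  simp only [zero_smul, add_zero, sub_zero] at h1
  constructor
  · intro h
    have h2 := h.sub h1
    simp only [sub_sub_cancel] at h2
    have h3 : Filter.Tendsto (fun _ : ℝ => fderiv ℝ ν (q - p) (w - v))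
        (nhdsWithin 0 (Set.Ioi 0)) (nhds 0) := by
      refine h2.tendsto_div_nhds_zero.congr' ?_
      filter_upwards [self_mem_nhdsWithin] with t ht
      have ht' : t ≠ 0 := ne_of_gt ht
      simp [ht']
    exact tendsto_nhds_unique tendsto_const_nhds h3
  · intro h
    simp only [h, smul_zero, sub_zero] at h1
    exact h1

/-! ### Flexes of braced grids as solutions of a linear system -/

/-- The direction of the horizontal bars of the grid of inclination `α`. -/
noncomputable def horDir (α : ℝ) : V2 := (Real.cos α, Real.sin α)

/-- The direction of the vertical bars of the grid of inclination `α`. -/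
noncomputable def verDir (α : ℝ) : V2 := (-Real.sin α, Real.cos α)

/-- The direction of the braces of colour `c` in the grid of inclination `α`. -/
noncomputable def braceDir (α : ℝ) (c : Bool) : V2 :=
  if c then horDir α + verDir α else verDir α - horDir α

lemma cross_horDir_verDir (α a b c d : ℝ) :
    (a • horDir α + b • verDir α).1 * (c • horDir α + d • verDir α).2 -
      (a • horDir α + b • verDir α).2 * (c • horDir α + d • verDir α).1 = a * d - b * c := by
  simp only [horDir, verDir, Prod.smul_mk, Prod.mk_add_mk, smul_eq_mul]
  linear_combination (a * d - b * c) * Real.sin_sq_add_cos_sq α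

lemma isFlex_bracedGrid_iff {ν : V2 → ℝ} (hν : IsNormFn ν) (hs : SmoothNorm ν) {m n : ℕ} (α : ℝ)
    (B : Set (Brace m n)) (u : Joint m n → V2) :
    IsFlex ν (bracedGrid m n α B) u ↔
      (∀ (j : Fin m) (k : Fin (n + 1)),
        fderiv ℝ ν (horDir α) (u (j.succ, k) - u (j.castSucc, k)) = 0) ∧
      (∀ (j : Fin (m + 1)) (k : Fin n),
        fderiv ℝ ν (verDir α) (u (j, k.succ) - u (j, k.castSucc)) = 0) ∧
      ∀ b ∈ B, fderiv ℝ ν (braceDir α b.2.2) (u (braceBar b).2 - u (braceBar b).1) = 0 := by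
  have ne0 : ∀ a b : ℝ, (a ≠ 0 ∨ b ≠ 0) → a • horDir α + b • verDir α ≠ 0 := by
    intro a b hab h0
    have h1 := cross_horDir_verDir α a b 0 1
    have h2 := cross_horDir_verDir α a b 1 0
    rw [h0] at h1 h2
    simp at h1 h2
    tauto
  have hh : horDir α ≠ 0 := by simpa using ne0 1 0 (by simp)
  have hv : verDir α ≠ 0 := by simpa using ne0 0 1 (by simp)
  have hb : ∀ c, braceDir α c ≠ 0 := by
    rintro (_ | _)
    · simpa [braceDir, sub_eq_neg_add] using ne0 (-1) 1 (by simp)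
    · simpa [braceDir] using ne0 1 1 (by simp)
  have H : ∀ (j : Fin m) (k : Fin (n + 1)), (bracedGrid m n α B).pos (j.succ, k) -
      (bracedGrid m n α B).pos (j.castSucc, k) = horDir α := fun j k => by
    ext <;> simp [bracedGrid, rotv, horDir] <;> ring
  have V : ∀ (j : Fin (m + 1)) (k : Fin n), (bracedGrid m n α B).pos (j, k.succ) -
      (bracedGrid m n α B).pos (j, k.castSucc) = verDir α := fun j k => by
    ext <;> simp [bracedGrid, rotv, verDir] <;> ring
  have D : ∀ b : Brace m n, (bracedGrid m n α B).pos (braceBar b).2 -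
      (bracedGrid m n α B).pos (braceBar b).1 = braceDir α b.2.2 := by
    rintro ⟨j, k, _ | _⟩ <;> ext <;>
      simp [bracedGrid, rotv, braceBar, braceDir, horDir, verDir] <;> ring
  constructor
  · intro h
    refine ⟨fun j k => ?_, fun j k => ?_, fun b hbB => ?_⟩
    · exact (bar_isLittleO_iff hν hs (H j k) hh _ _).1
        (h ((j.castSucc, k), (j.succ, k)) (Or.inl (Or.inl (by simp))))
    · exact (bar_isLittleO_iff hν hs (V j k) hv _ _).1
        (h ((j, k.castSucc), (j, k.succ)) (Or.inl (Or.inr (by simp))))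
    · exact (bar_isLittleO_iff hν hs (D b) (hb _) _ _).1 (h _ (Or.inr ⟨b, hbB, rfl⟩))
  · rintro ⟨h1, h2, h3⟩ e (he | ⟨b, hbB, rfl⟩)
    · obtain ⟨⟨j, k⟩, ⟨j', k'⟩⟩ := e
      rcases he with ⟨hj, hk⟩ | ⟨hj, hk⟩
      · simp only at hj hk
        subst hk
        obtain ⟨i, rfl⟩ : ∃ i : Fin m, j = i.castSucc := ⟨⟨j, by omega⟩, rfl⟩
        obtain rfl : j' = i.succ := Fin.ext (by simpa using hj.symm)
        exact (bar_isLittleO_iff hν hs (H i k) hh _ _).2 (h1 i k)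
      · simp only at hj hk
        subst hj
        obtain ⟨i, rfl⟩ : ∃ i : Fin n, k = i.castSucc := ⟨⟨k, by omega⟩, rfl⟩
        obtain rfl : k' = i.succ := Fin.ext (by simpa using hk.symm)
        exact (bar_isLittleO_iff hν hs (V j i) hv _ _).2 (h2 j i)
    · exact (bar_isLittleO_iff hν hs (D b) (hb _) _ _).2 (h3 b hbB)

/-- Every linear functional is determined by its values on the bar directions. -/
lemma apply_eq_bar_coords (α : ℝ) (φ : V2 →L[ℝ] ℝ) (w : V2) :
    φ w = (w.1 * (horDir α).1 + w.2 * (horDir α).2) * φ (horDir α) +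
      (w.1 * (verDir α).1 + w.2 * (verDir α).2) * φ (verDir α) := by
  have e : w = (w.1 * (horDir α).1 + w.2 * (horDir α).2) • horDir α +
      (w.1 * (verDir α).1 + w.2 * (verDir α).2) • verDir α := by
    ext
    · simp only [horDir, verDir, Prod.smul_mk, Prod.mk_add_mk, smul_eq_mul]
      linear_combination -w.1 * Real.sin_sq_add_cos_sq α
    · simp only [horDir, verDir, Prod.smul_mk, Prod.mk_add_mk, smul_eq_mul]
      linear_combination -w.2 * Real.sin_sq_add_cos_sq α
  conv_lhs => rw [e]
  simp

/-- Cramer's rule for linear functionals in the plane. -/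
lemma cramer_functional (α : ℝ) (φ₁ φ₂ φ : V2 →L[ℝ] ℝ) (w : V2) :
    (φ₁ (horDir α) * φ₂ (verDir α) - φ₁ (verDir α) * φ₂ (horDir α)) * φ w =
      (φ (horDir α) * φ₂ (verDir α) - φ (verDir α) * φ₂ (horDir α)) * φ₁ w +
        (φ₁ (horDir α) * φ (verDir α) - φ₁ (verDir α) * φ (horDir α)) * φ₂ w := by
  rw [apply_eq_bar_coords α φ w, apply_eq_bar_coords α φ₁ w, apply_eq_bar_coords α φ₂ w]
  ring

lemma bar_functionals_det_pos {ν : V2 → ℝ} (hν : IsNormFn ν) (hs : SmoothNorm ν)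
    (hc : StrictlyConvexNorm ν) (α : ℝ) :
    0 < fderiv ℝ ν (horDir α) (horDir α) * fderiv ℝ ν (verDir α) (verDir α) -
      fderiv ℝ ν (horDir α) (verDir α) * fderiv ℝ ν (verDir α) (horDir α) := by
  refine fderiv_cross_pos hν hs hc ?_
  have := cross_horDir_verDir α 1 0 0 1
  simp only [one_smul, zero_smul, add_zero, zero_add] at this
  rw [this]
  norm_num

/-- The norm derivatives in the bar directions are coordinates on the plane. -/
lemma exists_dual_basis {ν : V2 → ℝ} (hν : IsNormFn ν) (hs : SmoothNorm ν)
    (hc : StrictlyConvexNorm ν) (α : ℝ) :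
    (∃ T₁ T₂ : V2, fderiv ℝ ν (horDir α) T₁ = 1 ∧ fderiv ℝ ν (verDir α) T₁ = 0 ∧
      fderiv ℝ ν (horDir α) T₂ = 0 ∧ fderiv ℝ ν (verDir α) T₂ = 1) ∧
    ∀ w, fderiv ℝ ν (horDir α) w = 0 → fderiv ℝ ν (verDir α) w = 0 → w = 0 := by
  have hD := bar_functionals_det_pos hν hs hc α
  set P := horDir α
  set Q := verDir α
  set φ₁ := fderiv ℝ ν P
  set φ₂ := fderiv ℝ ν Q
  refine ⟨⟨(φ₁ P * φ₂ Q - φ₁ Q * φ₂ P)⁻¹ • (φ₂ Q • P - φ₂ P • Q),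
    (φ₁ P * φ₂ Q - φ₁ Q * φ₂ P)⁻¹ • (φ₁ P • Q - φ₁ Q • P), ?_, ?_, ?_, ?_⟩, ?_⟩
  · simp only [map_smul, map_sub, smul_eq_mul]
    rw [inv_mul_eq_one₀ hD.ne']
    ring
  · simp only [map_smul, map_sub, smul_eq_mul]
    ring
  · simp only [map_smul, map_sub, smul_eq_mul]
    ring
  · simp only [map_smul, map_sub, smul_eq_mul]
    rw [inv_mul_eq_one₀ hD.ne']
  · intro w h1 h2
    have h : ∀ φ : V2 →L[ℝ] ℝ, φ w = 0 := fun φ => by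
      have k := cramer_functional α φ₁ φ₂ φ w
      rw [h1, h2, mul_zero, mul_zero, add_zero] at k
      exact (mul_eq_zero.1 k).resolve_left hD.ne'
    exact Prod.ext (h (ContinuousLinearMap.fst ℝ ℝ ℝ)) (h (ContinuousLinearMap.snd ℝ ℝ ℝ))

/-- The derivative of the norm in a brace direction, in terms of those in the bar directions. -/
lemma exists_brace_coeff {ν : V2 → ℝ} (hν : IsNormFn ν) (hs : SmoothNorm ν)
    (hc : StrictlyConvexNorm ν) (α : ℝ) :
    ∃ lam : Bool → ℝ, (∀ c, lam c < 0) ∧ ∀ (c : Bool) (w : V2) (x y : ℝ),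
      fderiv ℝ ν (horDir α) w = x → fderiv ℝ ν (verDir α) w = (if c then y else -y) →
        (fderiv ℝ ν (braceDir α c) w = 0 ↔ y = lam c * x) := by
  set P := horDir α with hP
  set Q := verDir α with hQ
  have cr := fun (a b c d : ℝ) (h : a * d - b * c ≠ 0) =>
    fderiv_cross_pos hν hs hc (v := a • P + b • Q) (w := c • P + d • Q)
      (by rw [hP, hQ, cross_horDir_verDir]; exact h)
  have d12 := cr 1 0 0 1 (by norm_num)
  have d13 := cr 1 0 1 1 (by norm_num)
  have d32 := cr 1 1 0 1 (by norm_num)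
  have d14 := cr 1 0 (-1) 1 (by norm_num)
  have d42 := cr (-1) 1 0 1 (by norm_num)
  simp only [one_smul, zero_smul, add_zero, zero_add, neg_smul, map_add, map_neg] at d12 d13 d32 d14 d42
  rw [← sub_eq_neg_add Q P] at d14 d42
  set φ₁ := fderiv ℝ ν P
  set φ₂ := fderiv ℝ ν Q
  set φ₃ := fderiv ℝ ν (P + Q) with h3
  set φ₄ := fderiv ℝ ν (Q - P) with h4
  ring_nf at d12 d13 d32 d14 d42
  have e13 : 0 < φ₁ P * φ₃ Q - φ₁ Q * φ₃ P := by linarith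
  have e32 : 0 < φ₃ P * φ₂ Q - φ₃ Q * φ₂ P := by linarith
  have e14 : 0 < φ₁ P * φ₄ Q - φ₁ Q * φ₄ P := by linarith
  have e42 : φ₄ P * φ₂ Q - φ₄ Q * φ₂ P < 0 := by linarith
  have e12 : 0 < φ₁ P * φ₂ Q - φ₁ Q * φ₂ P := by linarith
  refine ⟨fun c => if c then -((φ₃ P * φ₂ Q - φ₃ Q * φ₂ P) / (φ₁ P * φ₃ Q - φ₁ Q * φ₃ P))
    else (φ₄ P * φ₂ Q - φ₄ Q * φ₂ P) / (φ₁ P * φ₄ Q - φ₁ Q * φ₄ P), ?_, ?_⟩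
  · rintro (_ | _)
    · simpa using div_neg_of_neg_of_pos e42 e14
    · simpa using div_pos e32 e13
  · rintro (_ | _) w x y hx hy
    · have k := cramer_functional α φ₁ φ₂ φ₄ w
      have hd : fderiv ℝ ν (braceDir α false) w = φ₄ w := by simp [braceDir, h4, hP, hQ]
      simp only [Bool.false_eq_true, if_false] at hy ⊢
      rw [hd, ← mul_eq_zero_iff_left e12.ne', k, hx, hy, div_mul_eq_mul_div, eq_div_iff e14.ne']
      constructor <;> intro h <;> linarith
    · have k := cramer_functional α φ₁ φ₂ φ₃ w
      have hd : fderiv ℝ ν (braceDir α true) w = φ₃ w := by simp [braceDir, h3, hP, hQ]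
      simp only [if_true] at hy ⊢
      rw [hd, ← mul_eq_zero_iff_left e12.ne', k, hx, hy, ← neg_div, div_mul_eq_mul_div,
        eq_div_iff e13.ne']
      constructor <;> intro h <;> linarith

/-- Infinitesimal rigidity of a braced grid in terms of the sheering of its ribbons. -/
lemma exists_normRigid_iff {ν : V2 → ℝ} (hν : IsNormFn ν) (hs : SmoothNorm ν)
    (hc : StrictlyConvexNorm ν) (m n : ℕ) (α : ℝ) :
    ∃ lam : Bool → ℝ, (∀ c, lam c < 0) ∧ ∀ B : Set (Brace m n),
      NormRigid ν (bracedGrid m n α B) ↔ ∀ (y : Fin m → ℝ) (x : Fin n → ℝ),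
        (∀ b ∈ B, y b.1 = lam b.2.2 * x b.2.1) → y = 0 ∧ x = 0 := by
  obtain ⟨lam, hlam, hbr⟩ := exists_brace_coeff hν hs hc α
  obtain ⟨⟨T₁, T₂, h11, h21, h12, h22⟩, hinj⟩ := exists_dual_basis hν hs hc α
  refine ⟨lam, hlam, fun B => ⟨fun hR y x hyx => ?_, fun hS u hu => ?_⟩⟩
  · set u : Joint m n → V2 := fun v => Fin.partialSum x v.2 • T₁ + Fin.partialSum y v.1 • T₂
      with hu
    have hconst := hR u <| (isFlex_bracedGrid_iff hν hs α B u).2 ⟨fun j k => by simp [hu, h12],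
      fun j k => by simp [hu, h21], fun b hb => by
        refine (hbr b.2.2 _ (x b.2.1) (y b.1) ?_ ?_).2 (hyx b hb)
        · obtain ⟨j, k, _ | _⟩ := b <;> simp [hu, braceBar, h11, h12, Fin.partialSum_succ]
        · obtain ⟨j, k, _ | _⟩ := b <;> simp [hu, braceBar, h21, h22, Fin.partialSum_succ]⟩
    constructor
    · funext j
      have h := congrArg (fderiv ℝ ν (verDir α)) (hconst (j.succ, 0) (j.castSucc, 0))
      simpa [hu, h21, h22, Fin.partialSum_succ] using h
    · funext k
      have h := congrArg (fderiv ℝ ν (horDir α)) (hconst (0, k.succ) (0, k.castSucc))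
      simpa [hu, h11, h12, Fin.partialSum_succ] using h
  · obtain ⟨hH, hV, hB⟩ := (isFlex_bracedGrid_iff hν hs α B u).1 hu
    simp only [map_sub, sub_eq_zero] at hH hV
    have hH0 : ∀ j k, fderiv ℝ ν (horDir α) (u (j, k)) = fderiv ℝ ν (horDir α) (u (0, k)) :=
      fun j k => by
        induction j using Fin.induction with
        | zero => rfl
        | succ i ih => rw [hH, ih]
    have hV0 : ∀ j k, fderiv ℝ ν (verDir α) (u (j, k)) = fderiv ℝ ν (verDir α) (u (j, 0)) :=
      fun j k => by
        induction k using Fin.induction with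
        | zero => rfl
        | succ i ih => rw [hV, ih]
    obtain ⟨hy, hx⟩ := hS
      (fun j => fderiv ℝ ν (verDir α) (u (j.succ, 0)) - fderiv ℝ ν (verDir α) (u (j.castSucc, 0)))
      (fun k => fderiv ℝ ν (horDir α) (u (0, k.succ)) - fderiv ℝ ν (horDir α) (u (0, k.castSucc)))
      fun b hb => by
        refine (hbr b.2.2 _ _ _ ?_ ?_).1 (hB b hb)
        · obtain ⟨j, k, _ | _⟩ := b <;> simp only [braceBar, map_sub, Bool.false_eq_true,
            if_true, if_false] <;> rw [hH0 j.succ, hH0 j.castSucc]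
        · obtain ⟨j, k, _ | _⟩ := b <;> simp only [braceBar, map_sub, Bool.false_eq_true,
            if_true, if_false] <;> rw [hV0 j.succ, hV0 j.castSucc]
          rw [neg_sub]
    have hH1 : ∀ k, fderiv ℝ ν (horDir α) (u (0, k)) = fderiv ℝ ν (horDir α) (u (0, 0)) :=
      fun k => by
        induction k using Fin.induction with
        | zero => rfl
        | succ i ih => rw [← ih]; exact sub_eq_zero.1 (congrFun hx i)
    have hV1 : ∀ j, fderiv ℝ ν (verDir α) (u (j, 0)) = fderiv ℝ ν (verDir α) (u (0, 0)) :=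
      fun j => by
        induction j using Fin.induction with
        | zero => rfl
        | succ i ih => rw [← ih]; exact sub_eq_zero.1 (congrFun hy i)
    intro v w
    refine sub_eq_zero.1 (hinj _ ?_ ?_)
    · rw [map_sub, sub_eq_zero, hH0 v.1 v.2, hH0 w.1 w.2, hH1, hH1 w.2]
    · rw [map_sub, sub_eq_zero, hV0 v.1 v.2, hV0 w.1 w.2, hV1, hV1 w.1]

/-! ### Gains of cycles in the bicoloured braces graph -/

/-- Walks in a bipartite graph on rows and columns alternate between the two sides. -/
lemma isLeft_getVert {m n : ℕ} {G : SimpleGraph (Fin m ⊕ Fin n)}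
    (hG : ∀ v w, G.Adj v w → v.isLeft = !w.isLeft) {v w : Fin m ⊕ Fin n} (p : G.Walk v w)
    (i : ℕ) (hi : i ≤ p.length) : (p.getVert i).isLeft = (v.isLeft ^^ decide (i % 2 = 1)) := by
  induction i with
  | zero => simp
  | succ i ih =>
    have h1 := hG _ _ (p.adj_getVert_succ (i := i) (by omega))
    rw [ih (by omega)] at h1
    have h2 : decide ((i + 1) % 2 = 1) = !decide (i % 2 = 1) := by
      rw [← decide_not, decide_eq_decide]
      omega
    rw [h2, Bool.xor_not, h1, Bool.not_not]

/-- If all cycles in `B` are dependently coloured then there is an integer potential on the rows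
and columns that drops by `1` along blue edges and by `0` along red ones. -/
lemma exists_potential {m n : ℕ} (B : Set (Brace m n))
    (hB : ∀ C : BCycle m n, C.edges ⊆ B → C.DepColouring) :
    ∃ f : Fin m ⊕ Fin n → ℤ, ∀ b ∈ B,
      f (Sum.inl b.1) - f (Sum.inr b.2.1) = if b.2.2 then 1 else 0 := by
  induction B, B.toFinite using Set.Finite.induction_on with
  | empty => exact ⟨0, by simp⟩
  | @insert e B he _ ih =>
    obtain ⟨f, hf⟩ := ih fun C hC => hB C (hC.trans (Set.subset_insert _ _))
    obtain ⟨j, k, c⟩ := e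
    let G : SimpleGraph (Fin m ⊕ Fin n) :=
      { Adj := bracesAdj B
        symm := ⟨fun v w ⟨e, he, h⟩ => ⟨e, he, h.symm⟩⟩
        loopless := ⟨by rintro v ⟨e, _, ⟨rfl, h⟩ | ⟨rfl, h⟩⟩ <;> simp at h⟩ }
    have hG : ∀ v w, G.Adj v w → v.isLeft = !w.isLeft := by
      rintro v w ⟨e, _, ⟨rfl, rfl⟩ | ⟨rfl, rfl⟩⟩ <;> rfl
    by_cases hr : G.Reachable (Sum.inl j) (Sum.inr k)
    · refine ⟨f, fun b hb => ?_⟩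
      rcases hb with rfl | hb
      swap
      · exact hf b hb
      classical
      obtain ⟨p, hp⟩ := hr.some.toPath
      obtain ⟨K, hK⟩ : ∃ K, p.length = 2 * K + 1 := by
        have h := isLeft_getVert hG p p.length le_rfl
        rw [p.getVert_length] at h
        have h' : p.length % 2 = 1 := by simpa using h
        exact ⟨p.length / 2, by omega⟩
      have hrow : ∀ i : Fin (K + 1), ∃ r, p.getVert (2 * i) = Sum.inl r := fun i => by
        have h := isLeft_getVert hG p (2 * i) (by omega)
        exact Sum.isLeft_iff.1 (by simpa using h)
      have hcol : ∀ i : Fin (K + 1), ∃ r, p.getVert (2 * i + 1) = Sum.inr r := fun i => by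
        have h := isLeft_getVert hG p (2 * i + 1) (by omega)
        refine Sum.isRight_iff.1 ?_
        rw [← Sum.not_isLeft, h]
        simp [Nat.add_mod]
      choose row hrow using hrow
      choose col hcol using hcol
      have hc1 : ∀ i : Fin (K + 1), ∃ d, (row i, col i, d) ∈ B := fun i => by
        have h : bracesAdj B _ _ := p.adj_getVert_succ (i := 2 * i) (by omega)
        rw [hrow, hcol] at h
        obtain ⟨⟨_, _, d⟩, hd, h | h⟩ := h
        · simp only [Sum.inl.injEq, Sum.inr.injEq] at h
          exact ⟨d, by rw [h.1, h.2]; exact hd⟩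
        · simp at h
      have hrow0 : row 0 = j := by
        have h := hrow 0
        simpa using h.symm
      have hcolK : col (Fin.last K) = k := by
        have h := hcol (Fin.last K)
        rw [Fin.val_last, ← hK, p.getVert_length] at h
        simpa using h.symm
      have hc2 : ∀ i : Fin (K + 1), ∃ d, (row (i + 1), col i, d) ∈ insert (j, k, c) B ∧
          (i ≠ Fin.last K → (row (i + 1), col i, d) ∈ B) ∧ (i = Fin.last K → d = c) := fun i => by
        by_cases hi : i = Fin.last K
        · refine ⟨c, Or.inl ?_, fun h => absurd hi h, fun _ => rfl⟩
          rw [hi, hcolK, Fin.last_add_one, hrow0]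
        · have hlt : (i : ℕ) < K := lt_of_le_of_ne (by omega) fun h => hi (Fin.ext h)
          have h : bracesAdj B _ _ := p.adj_getVert_succ (i := 2 * i + 1) (by omega)
          have hv : ((i + 1 : Fin (K + 1)) : ℕ) = i + 1 :=
            Fin.val_add_one_of_lt (Fin.lt_last_iff_ne_last.2 hi)
          rw [show 2 * (i : ℕ) + 1 + 1 = 2 * ((i + 1 : Fin (K + 1)) : ℕ) by omega, hrow,
            hcol] at h
          obtain ⟨⟨_, _, d⟩, hd, h | h⟩ := h
          · simp at h
          · simp only [Sum.inl.injEq, Sum.inr.injEq] at h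
            have hm : (row (i + 1), col i, d) ∈ B := by rw [h.1, h.2]; exact hd
            exact ⟨d, Or.inr hm, fun _ => hm, fun h => absurd h hi⟩
      choose c1 hc1 using hc1
      choose c2 hc2 hc2B hc2c using hc2
      let C : BCycle m n :=
        { k := K, row := row, col := col, c1 := c1, c2 := c2
          rowInj := fun a b hab => by
            have h := hp.getVert_injOn (show 2 * (a : ℕ) ∈ {i | i ≤ p.length} by
              simp only [Set.mem_ofPred_eq]; omega) (show 2 * (b : ℕ) ∈ {i | i ≤ p.length} by
              simp only [Set.mem_ofPred_eq]; omega) (by rw [hrow, hrow, hab])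
            omega
          colInj := fun a b hab => by
            have h := hp.getVert_injOn (show 2 * (a : ℕ) + 1 ∈ {i | i ≤ p.length} by
              simp only [Set.mem_ofPred_eq]; omega) (show 2 * (b : ℕ) + 1 ∈ {i | i ≤ p.length} by
              simp only [Set.mem_ofPred_eq]; omega) (by rw [hcol, hcol, hab])
            omega
          nontriv := by
            rintro rfl heq
            refine he ?_
            have h := hc1 (Fin.last 0)
            rwa [hcolK, heq, hc2c _ rfl, Fin.last_zero, hrow0] at h }
      have hdep : C.DepColouring := hB C <| by
        rintro _ (⟨i, rfl⟩ | ⟨i, rfl⟩)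
        · exact Or.inr (hc1 i)
        · exact hc2 i
      have hsum : ∑ i, (if c1 i then (1 : ℤ) else 0) = ∑ i, if c2 i then (1 : ℤ) else 0 := by
        rw [Finset.sum_boole, Finset.sum_boole]
        exact_mod_cast hdep
      have h1 : ∀ i, (if c1 i then (1 : ℤ) else 0) = f (Sum.inl (row i)) - f (Sum.inr (col i)) :=
        fun i => (hf _ (hc1 i)).symm
      have hshift : ∑ i, f (Sum.inl (row (i + 1))) = ∑ i, f (Sum.inl (row i)) :=
        Equiv.sum_comp (Equiv.addRight (1 : Fin (K + 1))) fun i => f (Sum.inl (row i))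
      have hz : ∑ i, (f (Sum.inl (row (i + 1))) - f (Sum.inr (col i)) -
          if c2 i then (1 : ℤ) else 0) = 0 := by
        rw [Finset.sum_sub_distrib, Finset.sum_sub_distrib, hshift, ← hsum,
          Finset.sum_congr rfl fun i _ => h1 i, Finset.sum_sub_distrib, sub_self]
      rw [Finset.sum_eq_single (Fin.last K)
        (fun i _ hi => sub_eq_zero.2 (hf _ (hc2B i hi))) (by simp), Fin.last_add_one, hrow0, hcolK,
        hc2c _ rfl, sub_eq_zero] at hz
      exact hz
    · classical
      refine ⟨fun v => if G.Reachable (Sum.inl j) v then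
        f v + ((if c then 1 else 0) - (f (Sum.inl j) - f (Sum.inr k))) else f v, fun b hb => ?_⟩
      rcases hb with rfl | hb
      · simp only [SimpleGraph.Reachable.refl, if_true, if_neg hr]
        ring
      · have hadj : G.Adj (Sum.inl b.1) (Sum.inr b.2.1) := ⟨b, hb, Or.inl ⟨rfl, rfl⟩⟩
        have hiff : G.Reachable (Sum.inl j) (Sum.inl b.1) ↔
            G.Reachable (Sum.inl j) (Sum.inr b.2.1) :=
          ⟨fun h => h.trans hadj.reachable, fun h => h.trans hadj.symm.reachable⟩
        rw [← hf b hb]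
        simp only [hiff]
        split_ifs <;> ring

/-- The product of the coefficients over a set of edges depends only on the number of blue ones. -/
lemma prod_coeff {ι : Type*} [Fintype ι] {lam : Bool → ℝ} (h0 : lam false ≠ 0) (c : ι → Bool) :
    ∏ i, lam (c i) = lam false ^ Fintype.card ι *
      (lam true / lam false) ^ (Finset.univ.filter fun i => c i = true).card := by
  have h : ∀ i, lam (c i) = lam false * if c i = true then lam true / lam false else 1 :=
    fun i => by cases c i <;> simp [mul_div_cancel₀, h0]
  rw [Finset.prod_congr rfl fun i _ => h i, Finset.prod_mul_distrib, Finset.prod_const,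
    Finset.prod_ite, Finset.prod_const, Finset.prod_const_one, mul_one, Finset.card_univ]

/-- A solution of the brace equations vanishes on independently coloured cycles. -/
lemma BCycle.eq_zero_of_not_depColouring {m n : ℕ} {lam : Bool → ℝ} (hneg : ∀ c, lam c < 0)
    (hne : lam true ≠ lam false) (C : BCycle m n) (hC : ¬C.DepColouring) {y : Fin m → ℝ}
    {x : Fin n → ℝ} (h : ∀ b ∈ C.edges, y b.1 = lam b.2.2 * x b.2.1) : y (C.row 0) = 0 := by
  by_contra h0
  have e1 : ∀ i, y (C.row i) = lam (C.c1 i) * x (C.col i) := fun i => h _ (Or.inl ⟨i, rfl⟩)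
  have e2 : ∀ i, y (C.row (i + 1)) = lam (C.c2 i) * x (C.col i) := fun i => h _ (Or.inr ⟨i, rfl⟩)
  have hx : ∀ i, x (C.col i) ≠ 0 := fun i hi => by
    have hy : ∀ i, y (C.row i) ≠ 0 := fun i => by
      induction i using Fin.induction with
      | zero => exact h0
      | succ i ih =>
        rw [e1] at ih
        rw [← Fin.coeSucc_eq_succ, e2]
        exact mul_ne_zero (hneg _).ne (right_ne_zero_of_mul ih)
    exact hy i (by rw [e1, hi, mul_zero])
  have hprod : ∏ i, y (C.row (i + 1)) = ∏ i, y (C.row i) :=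
    Equiv.prod_comp (Equiv.addRight (1 : Fin (C.k + 1))) fun i => y (C.row i)
  rw [Finset.prod_congr rfl fun i _ => e1 i, Finset.prod_congr rfl fun i _ => e2 i,
    Finset.prod_mul_distrib, Finset.prod_mul_distrib] at hprod
  have hl := mul_right_cancel₀ (Finset.prod_ne_zero_iff.2 fun i _ => hx i) hprod
  have hf := (hneg false).ne
  rw [prod_coeff hf, prod_coeff hf] at hl
  have hl' := mul_left_cancel₀ (pow_ne_zero _ hf) hl
  refine hC (pow_right_injective₀ (div_pos_of_neg_of_neg (hneg true) (hneg false)) ?_ hl'.symm)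
  rwa [Ne, div_eq_one_iff_eq hf]

lemma bracesAdj.symm {m n : ℕ} {B : Set (Brace m n)} {v w : Fin m ⊕ Fin n}
    (h : bracesAdj B v w) : bracesAdj B w v :=
  h.imp fun _ he => ⟨he.1, he.2.symm⟩

/-- If the component of `v` has no independently coloured cycle, then the brace equations have a
nonzero solution supported on that component. -/
lemma exists_solution_of_depColouring {m n : ℕ} {lam : Bool → ℝ} (hneg : ∀ c, lam c < 0)
    (B : Set (Brace m n)) (v : Fin m ⊕ Fin n)
    (hv : ∀ C : BCycle m n, C.edges ⊆ B →
      Relation.ReflTransGen (bracesAdj B) v (Sum.inl (C.row 0)) → C.DepColouring) :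
    ∃ (y : Fin m → ℝ) (x : Fin n → ℝ), (∀ b ∈ B, y b.1 = lam b.2.2 * x b.2.1) ∧
      ¬(y = 0 ∧ x = 0) := by
  classical
  obtain ⟨f, hf⟩ := exists_potential
    {b ∈ B | Relation.ReflTransGen (bracesAdj B) v (Sum.inl b.1)} fun C hC =>
      hv C (fun e he => (hC he).1) (hC (Or.inl ⟨0, rfl⟩)).2
  have hf0 := (hneg false).ne
  have hr : lam true / lam false ≠ 0 := div_ne_zero (hneg true).ne hf0
  refine ⟨fun j => if Relation.ReflTransGen (bracesAdj B) v (Sum.inl j) then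
      lam false * (lam true / lam false) ^ f (Sum.inl j) else 0,
    fun k => if Relation.ReflTransGen (bracesAdj B) v (Sum.inr k) then
      (lam true / lam false) ^ f (Sum.inr k) else 0, fun b hb => ?_, fun ⟨hy, hx⟩ => ?_⟩
  · have hadj : bracesAdj B (Sum.inl b.1) (Sum.inr b.2.1) := ⟨b, hb, Or.inl ⟨rfl, rfl⟩⟩
    have hiff : Relation.ReflTransGen (bracesAdj B) v (Sum.inl b.1) ↔
        Relation.ReflTransGen (bracesAdj B) v (Sum.inr b.2.1) :=
      ⟨fun h => h.tail hadj, fun h => h.tail hadj.symm⟩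
    simp only [← hiff]
    split_ifs with hreach
    · have h := hf b ⟨hb, hreach⟩
      rw [sub_eq_iff_eq_add] at h
      rw [h, zpow_add₀ hr]
      cases b.2.2
      · simp
      · simp only [if_true, zpow_one]
        rw [← mul_assoc, mul_div_cancel₀ _ hf0]
    · simp
  · rcases v with j | k
    · have h := congrFun hy j
      simp only [Relation.ReflTransGen.refl, if_true, Pi.zero_apply] at h
      exact mul_ne_zero hf0 (zpow_ne_zero _ hr) h
    · have h := congrFun hx k
      simp only [Relation.ReflTransGen.refl, if_true, Pi.zero_apply] at h
      exact zpow_ne_zero _ hr h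

/-- The brace equations have only the zero solution exactly when the two coefficients differ and
each component of the braces graph contains an independently coloured cycle. -/
lemma brace_equations_injective_iff {m n : ℕ} (hm : 1 ≤ m) {lam : Bool → ℝ}
    (hneg : ∀ c, lam c < 0) (B : Set (Brace m n)) :
    (∀ (y : Fin m → ℝ) (x : Fin n → ℝ), (∀ b ∈ B, y b.1 = lam b.2.2 * x b.2.1) →
        y = 0 ∧ x = 0) ↔
      lam true ≠ lam false ∧ ∀ v : Fin m ⊕ Fin n, ∃ C : BCycle m n, C.edges ⊆ B ∧
        ¬C.DepColouring ∧ Relation.ReflTransGen (bracesAdj B) v (Sum.inl (C.row 0)) := by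
  constructor
  · refine fun h => ⟨fun heq => ?_, fun v => ?_⟩
    · have hall : ∀ c, lam c = lam false := by rintro (_ | _) <;> simp [heq]
      have h1 := (h (fun _ => lam false) (fun _ => 1) fun b _ => by simp [hall]).1
      exact (hneg false).ne (congrFun h1 ⟨0, hm⟩)
    · by_contra hcon
      push Not at hcon
      obtain ⟨y, x, hyx, hnz⟩ := exists_solution_of_depColouring hneg B v fun C hC hr => by
        by_contra hd
        exact hcon C hC hd hr
      exact hnz (h y x hyx)
  · rintro ⟨hne, hB⟩ y x hyx
    have hz : ∀ v w, Relation.ReflTransGen (bracesAdj B) v w → Sum.elim y x w = 0 →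
        Sum.elim y x v = 0 := by
      intro v w hvw hw
      induction hvw using Relation.ReflTransGen.head_induction_on with
      | refl => exact hw
      | head hadj _ ih =>
        obtain ⟨e, he, ⟨rfl, rfl⟩ | ⟨rfl, rfl⟩⟩ := hadj
        · have hx : x e.2.1 = 0 := ih
          simp [hyx e he, hx]
        · have hy : y e.1 = 0 := ih
          rw [hyx e he] at hy
          exact (mul_eq_zero.1 hy).resolve_left (hneg _).ne
    have hall : ∀ v, Sum.elim y x v = 0 := fun v => by
      obtain ⟨C, hC, hd, hr⟩ := hB v
      exact hz v _ hr (C.eq_zero_of_not_depColouring hneg hne hd fun b hb => hyx b (hC hb))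
    exact ⟨funext fun j => hall (Sum.inl j), funext fun k => hall (Sum.inr k)⟩

/-- Theorem 1.1: for a differentiable, strictly convex, non-Euclidean
norm, an `m × n` braced grid of inclination `α ∈ [0, π/2)` is infinitesimally rigid iff
the fully doubly braced grid is infinitesimally rigid and every vertex of the bicoloured
braces graph is joined to an independently coloured cycle of braces, i.e. the braces graph
is a spanning subgraph of `K²_{m,n}` with an independent cycle in each connected component. -/
theorem statement0 (m n : ℕ) (hm : 1 ≤ m) (hn : 1 ≤ n) (ν : V2 → ℝ)
    (hnorm : IsNormFn ν) (hdiff : SmoothNorm ν) (hconv : StrictlyConvexNorm ν)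
    (hne : NonEuclidean ν) (α : ℝ) (hα0 : 0 ≤ α) (hα1 : α < Real.pi / 2)
    (B : Set (Brace m n)) :
    NormRigid ν (bracedGrid m n α B) ↔
      NormRigid ν (bracedGrid m n α Set.univ) ∧
        ∀ v : Fin m ⊕ Fin n, ∃ C : BCycle m n, C.edges ⊆ B ∧ ¬C.DepColouring ∧
          Relation.ReflTransGen (bracesAdj B) v (Sum.inl (C.row 0)) := by
  obtain ⟨lam, hneg, hrigid⟩ := exists_normRigid_iff hnorm hdiff hconv m n α
  have hmono : NormRigid ν (bracedGrid m n α B) → NormRigid ν (bracedGrid m n α Set.univ) := by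
    rw [hrigid, hrigid]
    exact fun h y x hyx => h y x fun b _ => hyx b trivial
  refine ⟨fun h => ⟨hmono h, ?_⟩, fun ⟨hmax, hB⟩ => ?_⟩
  · exact ((brace_equations_injective_iff hm hneg B).1 ((hrigid B).1 h)).2
  · exact (hrigid B).2 ((brace_equations_injective_iff hm hneg B).2
      ⟨((brace_equations_injective_iff hm hneg _).1 ((hrigid _).1 hmax)).1, hB⟩)
end

section
/- Let G(B) be a braced m×n grid in the Euclidean plane (ℝ²,‖·‖₂) whose brace set contains braces in the three squares with labels (m₁,n₁), (m₂,n₁) and (m₁,n₂). Then for every Euclidean infinitesimal flex z of G(B), the restriction of z to the four joints of the bar 4-cycle bounding the square with label (m₂,n₂) is a rigid motion flex of that 4-cycle. -/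
open Asymptotics

/-- The horizontal velocity of a flex is constant along horizontal grid lines. -/
lemma IsEucFlex.fst_eq_of_same_height {m n : ℕ} {B : Set (Brace m n)} {z : Joint m n → V2}
    (hz : IsEucFlex (plainBracedGrid m n B) z) (j : Fin (m + 1)) (k : Fin (n + 1)) :
    (z (j, k)).1 = (z (0, k)).1 := by
  induction j using Fin.induction with
  | zero => rfl
  | succ i ih =>
    have h := hz ((i.castSucc, k), (i.succ, k)) (Or.inl (Or.inl ⟨by simp, rfl⟩))
    simp [dot, plainBracedGrid] at h
    linarith

/-- The vertical velocity of a flex is constant along vertical grid lines. -/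
lemma IsEucFlex.snd_eq_of_same_abscissa {m n : ℕ} {B : Set (Brace m n)} {z : Joint m n → V2}
    (hz : IsEucFlex (plainBracedGrid m n B) z) (j : Fin (m + 1)) (k : Fin (n + 1)) :
    (z (j, k)).2 = (z (j, 0)).2 := by
  induction k using Fin.induction with
  | zero => rfl
  | succ i ih =>
    have h := hz ((j, i.castSucc), (j, i.succ)) (Or.inl (Or.inr ⟨rfl, by simp⟩))
    simp [dot, plainBracedGrid] at h
    linarith

/-- A brace of either colour forces the shears of its two ribbons to cancel. -/
lemma IsEucFlex.shear_add_shear_eq_zero {m n : ℕ} {B : Set (Brace m n)} {z : Joint m n → V2}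
    (hz : IsEucFlex (plainBracedGrid m n B) z) {j : Fin m} {k : Fin n}
    (h : ∃ c, (j, k, c) ∈ B) :
    ((z (0, k.succ)).1 - (z (0, k.castSucc)).1) +
      ((z (j.succ, 0)).2 - (z (j.castSucc, 0)).2) = 0 := by
  obtain ⟨c, hc⟩ := h
  have h := hz _ (Or.inr ⟨_, hc, rfl⟩)
  cases c <;> simp [dot, plainBracedGrid, braceBar] at h <;>
    rw [hz.fst_eq_of_same_height j.succ, hz.fst_eq_of_same_height j.castSucc,
      hz.snd_eq_of_same_abscissa _ k.succ, hz.snd_eq_of_same_abscissa _ k.castSucc] at h <;>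
    linarith

/-- Lemma 2.1: if a Euclidean braced grid has braces in the squares
`(m₁,n₁)`, `(m₂,n₁)` and `(m₁,n₂)`, then any infinitesimal flex restricts to a rigid
motion flex on the four joints of the bar 4-cycle of the square `(m₂,n₂)`. -/
theorem statement2 (m n : ℕ) (B : Set (Brace m n)) (m₁ m₂ : Fin m) (n₁ n₂ : Fin n)
    (h1 : ∃ c, (m₁, n₁, c) ∈ B) (h2 : ∃ c, (m₂, n₁, c) ∈ B) (h3 : ∃ c, (m₁, n₂, c) ∈ B)
    (z : Joint m n → V2) (hz : IsEucFlex (plainBracedGrid m n B) z) :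
    ∃ (c : V2) (θ : ℝ), ∀ v : Joint m n,
      (v.1 = m₂.castSucc ∨ v.1 = m₂.succ) → (v.2 = n₂.castSucc ∨ v.2 = n₂.succ) →
        z v = c + θ • rot90 ((plainBracedGrid m n B).pos v) := by
  have e1 := hz.shear_add_shear_eq_zero h1
  have e2 := hz.shear_add_shear_eq_zero h2
  have e3 := hz.shear_add_shear_eq_zero h3
  set θ : ℝ := (z (m₂.succ, 0)).2 - (z (m₂.castSucc, 0)).2 with hθ
  refine ⟨((z (0, n₂.castSucc)).1 + θ * n₂, (z (m₂.castSucc, 0)).2 - θ * m₂), θ, ?_⟩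
  rintro ⟨j, k⟩ hj hk
  refine Prod.ext ?_ ?_
  · rw [hz.fst_eq_of_same_height]
    rcases hk with rfl | rfl <;> simp [plainBracedGrid, rot90] <;> linarith
  · rw [hz.snd_eq_of_same_abscissa]
    rcases hj with rfl | rfl <;> simp [plainBracedGrid, rot90] <;> linarith
end

section
/- Let G(B) be a finite braced m×n grid in the Euclidean plane (ℝ²,‖·‖₂). Then the space M_rig of rigid motion infinitesimal flexes equals {u ∈ M : σ(u) ∈ ℝ·1}, where M is the flex space of the unbraced grid, σ is the sheer map and 1 is the all-ones ribbon sheer field. -/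
open Asymptotics

/-- Coordinates of `Σ_l d_l u_l` at a joint: horizontal lines contribute the first one,
vertical lines the second one. -/
theorem sum_smul_lineField_apply {m n : ℕ} (d : LineIdx m n → ℝ) (v : Joint m n) :
    (∑ l : LineIdx m n, d l • lineField m n l) v = (d (Sum.inl v.2), d (Sum.inr v.1)) := by
  rw [Finset.sum_apply, Fintype.sum_sum_type]
  ext <;> simp [lineField, Prod.fst_sum, Prod.snd_sum, apply_ite Prod.fst, apply_ite Prod.snd]

/-- A finite sequence with constant increments is affine. -/
theorem eq_add_mul_of_sub_eq {N : ℕ} {f : Fin (N + 1) → ℝ} {a : ℝ}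
    (h : ∀ i : Fin N, f i.succ - f i.castSucc = a) (i : Fin (N + 1)) :
    f i = f 0 + a * (i : ℝ) := by
  induction i using Fin.induction with
  | zero => simp
  | succ i ih =>
    have := h i
    simp only [Fin.val_succ, Fin.val_castSucc, Nat.cast_add, Nat.cast_one] at ih ⊢
    linarith

/-- Lemma 2.2: for a finite Euclidean braced grid, the rigid motion
infinitesimal flexes are exactly the elements `u = Σ_l d_l u_l` of the flex space `M`
of the unbraced grid whose sheer field `σ(u)` is a constant multiple of the all-ones
ribbon field. -/
theorem statement4 (m n : ℕ) (hm : 1 ≤ m) (hn : 1 ≤ n) (B : Set (Brace m n))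
    (d : LineIdx m n → ℝ) :
    IsRigidMotionFlex (plainBracedGrid m n B)
        (∑ l : LineIdx m n, d l • lineField m n l) ↔
      ∃ c : ℝ, ∀ ρ : RibbonIdx m n, sheer d ρ = c := by
  constructor
  · rintro ⟨c, θ, h⟩
    have hcoord (j : Fin (m + 1)) (k : Fin (n + 1)) :
        d (Sum.inl k) = c.1 - θ * (k : ℝ) ∧ d (Sum.inr j) = c.2 + θ * (j : ℝ) := by
      have := (sum_smul_lineField_apply d (j, k)).symm.trans (h (j, k))
      simpa [Prod.ext_iff, plainBracedGrid, rot90, sub_eq_add_neg] using this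
    refine ⟨θ, ?_⟩
    rintro (j | k)
    · simp only [sheer, (hcoord _ 0).2, Fin.val_succ, Fin.val_castSucc, Nat.cast_add,
        Nat.cast_one]
      ring
    · simp only [sheer, (hcoord 0 _).1, Fin.val_succ, Fin.val_castSucc, Nat.cast_add,
        Nat.cast_one]
      ring
  · rintro ⟨c, h⟩
    have hvert := eq_add_mul_of_sub_eq (f := fun j => d (Sum.inr j)) fun j => h (Sum.inl j)
    have hhor := eq_add_mul_of_sub_eq (f := fun k => d (Sum.inl k)) (a := -c) fun k => by
      rw [← h (Sum.inr k)]
      simp [sheer]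
    refine ⟨(d (Sum.inl 0), d (Sum.inr 0)), c, fun v => ?_⟩
    rw [sum_smul_lineField_apply]
    ext
    · simpa [plainBracedGrid, rot90] using hhor v.2
    · simpa [plainBracedGrid, rot90] using hvert v.1
end

section
/- Let G(B) be a braced m×n grid in the Euclidean plane and let b ∈ B be a brace. A velocity field u ∈ M restricts to a Euclidean infinitesimal flex of the braced bar 4-cycle for b (the 4-cycle of bars of the square of b together with the diagonal brace bar) if and only if f_b(σ(u)) = 0, where f_b is the linear functional on ℝ^R given by the row of the stress-sheer matrix SS(B) indexed by b. -/
open Asymptotics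

/-- The braced bar 4-cycle framework for a brace `b`: the four bars of the square of `b`
together with the diagonal brace bar. -/
noncomputable def braced4Cycle (m n : ℕ) (b : Brace m n) : Framework (Joint m n) where
  pos := fun v => ((v.1 : ℝ), (v.2 : ℝ))
  bars :=
    {((b.1.castSucc, b.2.1.castSucc), (b.1.succ, b.2.1.castSucc)),
     ((b.1.castSucc, b.2.1.castSucc), (b.1.castSucc, b.2.1.succ)),
     ((b.1.succ, b.2.1.castSucc), (b.1.succ, b.2.1.succ)),
     ((b.1.castSucc, b.2.1.succ), (b.1.succ, b.2.1.succ)),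
     braceBar b}

/-- A brace functional is the difference of the coordinates at the two ribbons of the brace. -/
theorem sum_eucSSRow_mul {m n : ℕ} (b : Brace m n) (s : RibbonIdx m n → ℝ) :
    ∑ ρ : RibbonIdx m n, eucSSRow b ρ * s ρ = s (Sum.inl b.1) - s (Sum.inr b.2.1) := by
  simp [eucSSRow, sub_eq_add_neg]

/-- Lemma 2.3 (i): a velocity field `u = Σ_l d_l u_l ∈ M` restricts to
a Euclidean infinitesimal flex of the braced bar 4-cycle for a brace `b ∈ B` iff the brace
functional `f_b` (the row of the stress-sheer matrix `SS(B)` indexed by `b`) vanishes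
on the sheer field `σ(u)`. -/
theorem statement5 (m n : ℕ) (B : Set (Brace m n)) (b : Brace m n) (hb : b ∈ B)
    (d : LineIdx m n → ℝ) :
    IsEucFlex (braced4Cycle m n b) (∑ l : LineIdx m n, d l • lineField m n l) ↔
      ∑ ρ : RibbonIdx m n, eucSSRow b ρ * sheer d ρ = 0 := by
  rw [sum_eucSSRow_mul]
  obtain ⟨j, k, c⟩ := b
  cases c <;>
    simp only [IsEucFlex, braced4Cycle, braceBar, sheer, Set.mem_insert_iff,
      Set.mem_singleton_iff, forall_eq_or_imp, forall_eq, sum_smul_lineField_apply] <;>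
    simp [dot] <;>
    constructor <;> intro h <;> linarith
end

section
/- A braced m×n grid G(B) in the Euclidean plane is infinitesimally rigid if and only if the rank of its stress-sheer matrix SS(B) equals m+n−1. -/
open Asymptotics

theorem eucSSRow_dotProduct {m n : ℕ} (b : Brace m n) (x : RibbonIdx m n → ℝ) :
    eucSSRow b ⬝ᵥ x = x (Sum.inl b.1) - x (Sum.inr b.2.1) := by
  simp [dotProduct, eucSSRow, Fintype.sum_sum_type, sub_eq_add_neg]

theorem dot_braceBar_eq_zero_iff {m n : ℕ} (B : Set (Brace m n)) (b : Brace m n)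
    (f : Fin (n + 1) → ℝ) (g : Fin (m + 1) → ℝ) :
    dot ((f (braceBar b).1.2, g (braceBar b).1.1) - (f (braceBar b).2.2, g (braceBar b).2.1))
        ((plainBracedGrid m n B).pos (braceBar b).1 - (plainBracedGrid m n B).pos (braceBar b).2)
          = 0 ↔
      g b.1.succ - g b.1.castSucc = f b.2.1.castSucc - f b.2.1.succ := by
  obtain ⟨j, k, c⟩ := b
  cases c <;> simp [braceBar, dot, plainBracedGrid] <;>
    constructor <;> intro h <;> linarith

/-- A velocity field moving each line of the grid along itself is a flex iff the sheers of the two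
ribbons meeting at each brace agree. -/
theorem isEucFlex_lineVelocities_iff {m n : ℕ} (B : Set (Brace m n))
    (f : Fin (n + 1) → ℝ) (g : Fin (m + 1) → ℝ) :
    IsEucFlex (plainBracedGrid m n B) (fun v => (f v.2, g v.1)) ↔
      ∀ b ∈ B, g b.1.succ - g b.1.castSucc = f b.2.1.castSucc - f b.2.1.succ := by
  constructor
  · exact fun h b hb => (dot_braceBar_eq_zero_iff B b f g).1 (h _ (Or.inr ⟨b, hb, rfl⟩))
  · rintro h e ((⟨-, h2⟩ | ⟨h1, -⟩) | ⟨b, hb, rfl⟩)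
    · simp [dot, plainBracedGrid, h2]
    · simp [dot, plainBracedGrid, h1]
    · exact (dot_braceBar_eq_zero_iff B b f g).2 (h b hb)

theorem eq_zero_add_mul_of_succ_sub_castSucc {n : ℕ} {f : Fin (n + 1) → ℝ} {θ : ℝ}
    (h : ∀ i : Fin n, f i.succ - f i.castSucc = θ) (k : Fin (n + 1)) :
    f k = f 0 + θ * (k : ℕ) := by
  induction k using Fin.induction with
  | zero => simp
  | succ i ih =>
    have := h i
    simp only [Fin.val_castSucc, Fin.val_succ] at ih ⊢
    push_cast
    linarith

theorem IsEucFlex.eq_lineVelocities {m n : ℕ} {B : Set (Brace m n)} {u : Joint m n → V2}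
    (hu : IsEucFlex (plainBracedGrid m n B) u) :
    u = fun v => ((u (0, v.2)).1, (u (v.1, 0)).2) := by
  funext ⟨j, k⟩
  refine Prod.ext ?_ ?_
  · have h := eq_zero_add_mul_of_succ_sub_castSucc (f := fun i => (u (i, k)).1) (θ := 0)
      (fun i => by
        have := hu ((i.castSucc, k), (i.succ, k)) (Or.inl (Or.inl ⟨by simp, rfl⟩))
        simp [dot, plainBracedGrid] at this
        linarith) j
    simpa using h
  · have h := eq_zero_add_mul_of_succ_sub_castSucc (f := fun i => (u (j, i)).2) (θ := 0)
      (fun i => by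
        have := hu ((j, i.castSucc), (j, i.succ)) (Or.inl (Or.inr ⟨rfl, by simp⟩))
        simp [dot, plainBracedGrid] at this
        linarith) k
    simpa using h

/-- A braced grid is infinitesimally rigid iff the only sheers compatible with the braces are
the constant ones. -/
theorem eucRigid_plainBracedGrid_iff {m n : ℕ} (B : Set (Brace m n)) :
    EucRigid (plainBracedGrid m n B) ↔
      ∀ x : RibbonIdx m n → ℝ, (∀ b ∈ B, x (Sum.inl b.1) = x (Sum.inr b.2.1)) →
        ∃ θ : ℝ, ∀ ρ, x ρ = θ := by
  constructor
  · intro hR x hx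
    obtain ⟨c, θ, h⟩ := hR _ ((isEucFlex_lineVelocities_iff B
      (fun k => -Fin.partialSum (fun i => x (Sum.inr i)) k)
      (Fin.partialSum fun i => x (Sum.inl i))).2 fun b hb => by
        simp [Fin.partialSum_succ, hx b hb])
    refine ⟨θ, ?_⟩
    rintro (j | k)
    · have h1 := congrArg Prod.snd (h (j.succ, 0))
      have h2 := congrArg Prod.snd (h (j.castSucc, 0))
      simp [Fin.partialSum_succ, rot90, plainBracedGrid] at h1 h2
      linarith
    · have h1 := congrArg Prod.fst (h (0, k.succ))
      have h2 := congrArg Prod.fst (h (0, k.castSucc))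
      simp [Fin.partialSum_succ, rot90, plainBracedGrid] at h1 h2
      linarith
  · intro H u hu
    have hu' := hu.eq_lineVelocities
    rw [hu', isEucFlex_lineVelocities_iff B (fun k => (u (0, k)).1) (fun j => (u (j, 0)).2)] at hu
    obtain ⟨θ, hθ⟩ := H (sheer (Sum.elim (fun k => (u (0, k)).1) fun j => (u (j, 0)).2)) hu
    refine ⟨u (0, 0), θ, fun v => ?_⟩
    have h1 := eq_zero_add_mul_of_succ_sub_castSucc (f := fun k => (u (0, k)).1) (θ := -θ)
      (fun k => by have := hθ (Sum.inr k); simp [sheer] at this; linarith) v.2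
    have h2 := eq_zero_add_mul_of_succ_sub_castSucc (f := fun j => (u (j, 0)).2) (θ := θ)
      (fun j => hθ (Sum.inl j)) v.1
    rw [hu']
    refine Prod.ext ?_ ?_
    · simpa [rot90, plainBracedGrid] using h1
    · simpa [rot90, plainBracedGrid] using h2

theorem Matrix.rank_eq_card_sub_one_iff {ι κ : Type*} [Fintype κ] [Nonempty κ]
    {A : Matrix ι κ ℝ} (hA : A.mulVec 1 = 0) :
    A.rank = Fintype.card κ - 1 ↔ ∀ x, A.mulVec x = 0 → ∃ θ : ℝ, ∀ i, x i = θ := by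
  classical
  have hdim := A.mulVecLin.finrank_range_add_finrank_ker
  rw [Module.finrank_fintype_fun_eq_card] at hdim
  have hcard : 0 < Fintype.card κ := Fintype.card_pos
  let v : LinearMap.ker A.mulVecLin := ⟨1, by simpa using hA⟩
  have hv : v ≠ 0 := fun h => one_ne_zero (congrArg Subtype.val h)
  have hpos : 0 < Module.finrank ℝ (LinearMap.ker A.mulVecLin) :=
    Module.finrank_pos_iff_exists_ne_zero.2 ⟨v, hv⟩
  have hker : A.rank = Fintype.card κ - 1 ↔
      Module.finrank ℝ (LinearMap.ker A.mulVecLin) = 1 := by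
    unfold Matrix.rank
    omega
  rw [hker, finrank_eq_one_iff_of_nonzero' v hv]
  constructor
  · intro h x hx
    obtain ⟨c, hc⟩ := h ⟨x, by simpa using hx⟩
    refine ⟨c, fun i => ?_⟩
    simpa [v] using (congrFun (congrArg Subtype.val hc) i).symm
  · rintro h ⟨x, hx⟩
    obtain ⟨θ, hθ⟩ := h x (by simpa using hx)
    exact ⟨θ, Subtype.ext (funext fun i => by simp [v, hθ i])⟩

/-- Lemma 2.3 (ii): a Euclidean braced `m × n` grid is infinitesimally
rigid iff its stress-sheer matrix `SS(B)` has rank `m + n - 1`. -/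
theorem statement6 (m n : ℕ) (hm : 1 ≤ m) (hn : 1 ≤ n) (B : Finset (Brace m n)) :
    EucRigid (plainBracedGrid m n ↑B) ↔
      (Matrix.of fun (b : B) (ρ : RibbonIdx m n) => eucSSRow (b : Brace m n) ρ).rank
        = m + n - 1 := by
  have : Nonempty (RibbonIdx m n) := ⟨Sum.inl ⟨0, hm⟩⟩
  have hmulVec (x : RibbonIdx m n → ℝ) (b : B) :
      (Matrix.of fun (b : B) (ρ : RibbonIdx m n) => eucSSRow (b : Brace m n) ρ).mulVec x b =
        x (Sum.inl b.1.1) - x (Sum.inr b.1.2.1) := eucSSRow_dotProduct b.1 x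
  have hrank := Matrix.rank_eq_card_sub_one_iff
    (A := Matrix.of fun (b : B) (ρ : RibbonIdx m n) => eucSSRow (b : Brace m n) ρ)
    (funext fun b => by simp [hmulVec])
  simp only [Fintype.card_sum, Fintype.card_fin] at hrank
  rw [hrank, eucRigid_plainBracedGrid_iff]
  simp [funext_iff, hmulVec, sub_eq_zero]
end
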